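/- arXiv:2212.11794 — 4 statements merged into one kernel-verified Lean document; each statement's English description precedes it below -/
import Mathlib

section
/- Let 0 < ν ≤ 1/2 and μ > 0, and fix t > 0. Then lim_{a → 0+} R_{μ,ν}(a,t) = t^{μ−1}/Γ(μ). -/
open Real MeasureTheory

/-- The auxiliary function `R_{μ,ν}(a,t)` defined by its series representation. -/
noncomputable def R (μ ν a t : ℝ) : ℝ :=
  t ^ (μ - 1) * ∑' j : ℕ, (-(a * t ^ (-ν))) ^ j / (j.factorial * Real.Gamma (-ν * j + μ))

lemma Real.abs_inv_Gamma_le_Gamma_one_sub {x : ℝ} (hx : x < 1) :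
    |(Real.Gamma x)⁻¹| ≤ Real.Gamma (1 - x) := by
  have hpos : 0 < Real.Gamma (1 - x) := Real.Gamma_pos_of_pos (by linarith)
  rcases eq_or_ne (Real.Gamma x) 0 with h0 | h0
  · simpa [h0] using hpos.le
  have href := Real.Gamma_mul_Gamma_one_sub x
  have hsin : Real.sin (π * x) ≠ 0 := by
    intro h
    rw [h, div_zero] at href
    exact mul_ne_zero h0 hpos.ne' href
  have hmul : Real.Gamma x * Real.Gamma (1 - x) * Real.sin (π * x) = π := by
    rw [href, div_mul_cancel₀ _ hsin]
  have habs : |Real.Gamma x| * Real.Gamma (1 - x) * |Real.sin (π * x)| = π := by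
    rw [← abs_of_pos hpos, ← abs_mul, ← abs_mul, hmul, abs_of_pos pi_pos]
  have hge : 1 ≤ |Real.Gamma x| * Real.Gamma (1 - x) := by
    have h1 := mul_le_mul_of_nonneg_left (Real.abs_sin_le_one (π * x))
      (mul_nonneg (abs_nonneg (Real.Gamma x)) hpos.le)
    linarith [pi_gt_three]
  rw [abs_inv, inv_le_iff_one_le_mul₀' (abs_pos.mpr h0)]
  exact hge

lemma eventually_abs_inv_factorial_mul_Gamma_le {μ ν : ℝ} (hν : 0 < ν) (hν' : ν ≤ 1)
    (hμ : 0 ≤ μ) :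
    ∀ᶠ j : ℕ in Filter.atTop,
      |((j.factorial : ℝ) * Real.Gamma (-ν * j + μ))⁻¹| ≤ (j : ℝ) + 1 := by
  have htop : Filter.Tendsto (fun j : ℕ => ν * (j : ℝ)) Filter.atTop Filter.atTop :=
    tendsto_natCast_atTop_atTop.const_mul_atTop hν
  filter_upwards [htop.eventually_ge_atTop (1 + μ)] with j hj
  have hjν : ν * (j : ℝ) ≤ j := mul_le_of_le_one_left j.cast_nonneg hν'
  have hmono : Real.Gamma (1 - (-ν * j + μ)) ≤ Real.Gamma (((j + 1 : ℕ) : ℝ) + 1) := by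
    apply Real.Gamma_strictMonoOn_Ici.monotoneOn
    · simp only [Set.mem_Ici]; linarith
    · simp only [Set.mem_Ici]; push_cast; linarith
    · push_cast; linarith
  rw [Real.Gamma_nat_eq_factorial, Nat.factorial_succ] at hmono
  have hle := (Real.abs_inv_Gamma_le_Gamma_one_sub
    (show -ν * (j : ℝ) + μ < 1 by linarith)).trans hmono
  have hfac : (0 : ℝ) < j.factorial := by exact_mod_cast j.factorial_pos
  rw [mul_inv, abs_mul, abs_of_pos (inv_pos.mpr hfac), inv_mul_le_iff₀ hfac]
  push_cast at hle
  linarith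

theorem R_tendsto_a_zero (μ ν t : ℝ) (hν : 0 < ν) (hν' : ν ≤ 1 / 2) (hμ : 0 < μ)
    (ht : 0 < t) :
    Filter.Tendsto (fun a => R μ ν a t) (nhdsWithin 0 (Set.Ioi 0))
      (nhds (t ^ (μ - 1) / Real.Gamma μ)) := by
  unfold R
  rw [div_eq_mul_inv]
  refine Filter.Tendsto.const_mul _ (Filter.Tendsto.mono_left ?_ nhdsWithin_le_nhds)
  set c : ℕ → ℝ := fun j => ((j.factorial : ℝ) * Real.Gamma (-ν * j + μ))⁻¹ with hc
  have hz : Filter.Tendsto (fun a : ℝ => -(a * t ^ (-ν))) (nhds 0) (nhds 0) := by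
    have h : Continuous fun a : ℝ => -(a * t ^ (-ν)) := by fun_prop
    simpa using h.tendsto 0
  have hsum : Summable fun j : ℕ => (1 / 2 : ℝ) ^ j * |c j| := by
    have hg : Summable fun j : ℕ => ((j : ℝ) + 1) * (1 / 2 : ℝ) ^ j := by
      have h1 := summable_pow_mul_geometric_of_norm_lt_one 1
        (show ‖(1 / 2 : ℝ)‖ < 1 by norm_num)
      have h2 := summable_geometric_of_norm_lt_one (show ‖(1 / 2 : ℝ)‖ < 1 by norm_num)
      simpa [add_mul] using h1.add h2
    refine Summable.of_norm_bounded_eventually_nat hg ?_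
    filter_upwards [eventually_abs_inv_factorial_mul_Gamma_le hν (by linarith) hμ.le] with j hj
    rw [Real.norm_of_nonneg (by positivity), mul_comm]
    gcongr
  have hlim : (Real.Gamma μ)⁻¹ = ∑' j : ℕ, (0 : ℝ) ^ j * c j := by
    rw [tsum_eq_single 0 (fun j hj => by simp [hj])]
    simp [hc]
  rw [hlim]
  simp only [div_eq_mul_inv]
  refine tendsto_tsum_of_dominated_convergence hsum
    (fun j => (hz.pow j).mul_const (c j)) ?_
  filter_upwards [hz.eventually (Metric.ball_mem_nhds (0 : ℝ) (by norm_num : (0 : ℝ) < 1 / 2))]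
    with a ha j
  rw [dist_zero_right] at ha
  rw [norm_mul, norm_pow, Real.norm_eq_abs (_)⁻¹]
  gcongr
end

section
/- For every real z, Σ_{j=0}^∞ (−z)^j / (j! Γ(−j/2 + 1/2)) = e^{−z²/4}/√π, i.e. the Wright function satisfies W(−z; −1/2, 1/2) = e^{−z²/4}/√π. -/
open Real

theorem factorial_mul_Gamma_half_sub (k : ℕ) :
    ((2 * k).factorial : ℝ) * Real.Gamma (1 / 2 - k) = (-4) ^ k * k.factorial * √π := by
  induction k with
  | zero => simpa using Real.Gamma_one_half_eq
  | succ k ih =>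
    have hs : (1 / 2 - ((k + 1 : ℕ) : ℝ)) ≠ 0 := by
      have : (0 : ℝ) ≤ k := k.cast_nonneg
      push_cast
      linarith
    have h := Real.Gamma_add_one hs
    rw [show (1 / 2 - ((k + 1 : ℕ) : ℝ)) + 1 = 1 / 2 - k by push_cast; ring] at h
    rw [h] at ih
    rw [show 2 * (k + 1) = 2 * k + 1 + 1 by ring, Nat.factorial_succ, Nat.factorial_succ,
      Nat.factorial_succ, pow_succ]
    push_cast at ih ⊢
    linear_combination (-4 * ((k : ℝ) + 1)) * ih

theorem wright_special_half (z : ℝ) :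
    ∑' j : ℕ, (-z) ^ j / (j.factorial * Real.Gamma (-(j : ℝ) / 2 + 1 / 2))
      = Real.exp (-(z ^ 2) / 4) / Real.sqrt π := by
  have hodd : HasSum (fun k : ℕ => (-z) ^ (2 * k + 1) / ((2 * k + 1).factorial *
      Real.Gamma (-((2 * k + 1 : ℕ) : ℝ) / 2 + 1 / 2))) 0 := by
    convert! hasSum_zero using 2 with k
    rw [show -((2 * k + 1 : ℕ) : ℝ) / 2 + 1 / 2 = -(k : ℝ) by push_cast; ring,
      Real.Gamma_neg_nat_eq_zero]
    simp
  have heven : HasSum (fun k : ℕ => (-z) ^ (2 * k) / ((2 * k).factorial *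
      Real.Gamma (-((2 * k : ℕ) : ℝ) / 2 + 1 / 2))) (Real.exp (-(z ^ 2) / 4) / √π) := by
    rw [Real.exp_eq_exp_ℝ]
    convert! (NormedSpace.expSeries_div_hasSum_exp (-(z ^ 2) / 4)).div_const √π using 2 with k
    rw [show -((2 * k : ℕ) : ℝ) / 2 + 1 / 2 = 1 / 2 - (k : ℝ) by push_cast; ring,
      factorial_mul_Gamma_half_sub, pow_mul, neg_sq,
      show -(z ^ 2) / 4 = z ^ 2 / (-4) by ring, div_pow, div_div, div_div, mul_assoc]
  have h := HasSum.even_add_odd (f := fun j : ℕ =>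
    (-z) ^ j / (j.factorial * Real.Gamma (-(j : ℝ) / 2 + 1 / 2))) heven hodd
  rw [add_zero] at h
  exact h.tsum_eq
end

section
/- Let a > 0 and s > 0. Then ∫_0^∞ e^{−s t} · (a e^{−a²/(4t)})/(2 √(π t³)) dt = e^{−a √s}; that is, R_{0,1/2}(a,t) = a e^{−a²/(4t)}/(2√(π t³)) has Laplace transform s ↦ e^{−a s^{1/2}}. -/
open Real MeasureTheory

open Filter Topology Set

theorem integral_Ioi_of_hasDerivAt_of_nonneg_of_tendsto_nhdsGT {g g' : ℝ → ℝ} {a l m : ℝ}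
    (hderiv : ∀ x ∈ Ioi a, HasDerivAt g (g' x) x) (g'pos : ∀ x ∈ Ioi a, 0 ≤ g' x)
    (ha : Tendsto g (𝓝[>] a) (𝓝 m)) (hg : Tendsto g atTop (𝓝 l)) :
    ∫ x in Ioi a, g' x = l - m := by
  have hne : ∀ x ∈ Ioi a, Function.update g a m =ᶠ[𝓝 x] g := fun x hx => by
    filter_upwards [Ioi_mem_nhds (mem_Ioi.1 hx)] with y hy
    exact Function.update_of_ne (ne_of_gt hy) _ _
  have key := integral_Ioi_of_hasDerivAt_of_nonneg (g := Function.update g a m) (g' := g')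
    (a := a) (l := l) (by rwa [continuousWithinAt_update_same, Ici_sdiff_left])
    (fun x hx => (hderiv x hx).congr_of_eventuallyEq (hne x hx)) g'pos
    (hg.congr' (by
      filter_upwards [eventually_gt_atTop a] with y hy
      exact (Function.update_of_ne (ne_of_gt hy) _ _).symm))
  simpa using key

theorem hasDerivAt_integral_exp_neg_sq (x : ℝ) :
    HasDerivAt (fun y : ℝ => ∫ u in (0 : ℝ)..y, exp (-u ^ 2)) (exp (-x ^ 2)) x :=
  (by fun_prop : Continuous fun u : ℝ => exp (-u ^ 2)).integral_hasStrictDerivAt 0 x |>.hasDerivAt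

theorem tendsto_integral_exp_neg_sq_atTop :
    Tendsto (fun y : ℝ => ∫ u in (0 : ℝ)..y, exp (-u ^ 2)) atTop (𝓝 (√π / 2)) := by
  have h := intervalIntegral_tendsto_integral_Ioi 0
    (integrable_exp_neg_mul_sq one_pos).integrableOn tendsto_id
  rw [integral_gaussian_Ioi] at h
  simpa using h

theorem tendsto_integral_exp_neg_sq_atBot :
    Tendsto (fun y : ℝ => ∫ u in (0 : ℝ)..y, exp (-u ^ 2)) atBot (𝓝 (-(√π / 2))) := by
  refine (tendsto_integral_exp_neg_sq_atTop.comp tendsto_neg_atBot_atTop).neg.congr fun y => ?_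
  have h := intervalIntegral.integral_comp_neg (a := 0) (b := y) fun u : ℝ => exp (-u ^ 2)
  simp only [neg_sq, neg_zero] at h
  rw [h, Function.comp_apply, intervalIntegral.integral_symm, neg_neg]

theorem hasDerivAt_mul_sqrt_add_div_sqrt (b c : ℝ) {t : ℝ} (ht : 0 < t) :
    HasDerivAt (fun x => c * √x + b / √x) (c / (2 * √t) - b / (2 * √t ^ 3)) t := by
  have hpos : 0 < √t := sqrt_pos.2 ht
  have h := hasDerivAt_sqrt ht.ne'
  refine ((h.const_mul c).add ((hasDerivAt_const t b).div h hpos.ne')).congr_deriv ?_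
  field_simp
  ring

theorem tendsto_mul_sqrt_add_div_sqrt_atTop (b : ℝ) {c : ℝ} (hc : 0 < c) :
    Tendsto (fun x => c * √x + b / √x) atTop atTop :=
  (tendsto_sqrt_atTop.const_mul_atTop hc).atTop_add (tendsto_sqrt_atTop.const_div_atTop b)

theorem tendsto_inv_sqrt_nhdsGT_zero : Tendsto (fun x => (√x)⁻¹) (𝓝[>] 0) atTop := by
  refine tendsto_inv_nhdsGT_zero.comp (tendsto_nhdsWithin_iff.2 ⟨?_, ?_⟩)
  · simpa using (continuous_sqrt.tendsto 0).mono_left nhdsWithin_le_nhds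
  · filter_upwards [self_mem_nhdsWithin] with x hx using sqrt_pos.2 hx

theorem tendsto_mul_sqrt_nhdsGT_zero (c : ℝ) : Tendsto (fun x => c * √x) (𝓝[>] 0) (𝓝 0) := by
  simpa using ((continuous_sqrt.tendsto 0).const_mul c).mono_left nhdsWithin_le_nhds

theorem tendsto_mul_sqrt_add_div_sqrt_nhdsGT_of_pos {b : ℝ} (hb : 0 < b) (c : ℝ) :
    Tendsto (fun x => c * √x + b / √x) (𝓝[>] 0) atTop :=
  (tendsto_mul_sqrt_nhdsGT_zero c).add_atTop (tendsto_inv_sqrt_nhdsGT_zero.const_mul_atTop hb)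

theorem tendsto_mul_sqrt_add_div_sqrt_nhdsGT_of_neg {b : ℝ} (hb : b < 0) (c : ℝ) :
    Tendsto (fun x => c * √x + b / √x) (𝓝[>] 0) atBot :=
  (tendsto_mul_sqrt_nhdsGT_zero c).add_atBot
    (tendsto_inv_sqrt_nhdsGT_zero.const_mul_atTop_of_neg hb)

theorem exp_mul_exp_neg_sq_mul_sqrt_add_div_sqrt (b c : ℝ) {t : ℝ} (ht : 0 < t) :
    exp (2 * b * c) * exp (-(c * √t + b / √t) ^ 2) = exp (-(c ^ 2 * t) - b ^ 2 / t) := by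
  have hpos : 0 < √t := sqrt_pos.2 ht
  rw [← exp_add]
  congr 1
  obtain ⟨w, hw, rfl⟩ : ∃ w, 0 < w ∧ t = w ^ 2 := ⟨√t, hpos, (sq_sqrt ht.le).symm⟩
  rw [sqrt_sq hw.le]
  field_simp
  ring

theorem laplace_transform_R_zero_half (a s : ℝ) (ha : 0 < a) (hs : 0 < s) :
    ∫ t in Set.Ioi (0 : ℝ),
        Real.exp (-(s * t)) * (a * Real.exp (-(a ^ 2) / (4 * t)) / (2 * Real.sqrt (π * t ^ 3)))
      = Real.exp (-(a * Real.sqrt s)) := by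
  set c := √s
  have hc : 0 < c := sqrt_pos.2 hs
  have hcs : c ^ 2 = s := sq_sqrt hs.le
  have hpi : 0 < √π := sqrt_pos.2 pi_pos
  let G : ℝ → ℝ := fun y => ∫ u in (0 : ℝ)..y, exp (-u ^ 2)
  let F : ℝ → ℝ := fun t => (√π)⁻¹ * (exp (2 * (-(a / 2)) * c) * G (c * √t + -(a / 2) / √t)
    - exp (2 * (a / 2) * c) * G (c * √t + (a / 2) / √t))
  have hF : ∀ t ∈ Ioi (0 : ℝ), HasDerivAt F
      (exp (-(s * t)) * (a * exp (-(a ^ 2) / (4 * t)) / (2 * √(π * t ^ 3)))) t := by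
    intro t ht
    have ht : 0 < t := ht
    have hder (b : ℝ) := ((hasDerivAt_integral_exp_neg_sq (c * √t + b / √t)).comp t
      (hasDerivAt_mul_sqrt_add_div_sqrt b c ht)).const_mul (exp (2 * b * c))
    refine (((hder (-(a / 2))).sub (hder (a / 2))).const_mul (√π)⁻¹).congr_deriv ?_
    have hexp : exp (-(s * t)) * exp (-(a ^ 2) / (4 * t))
        = exp (-(c ^ 2 * t) - (a / 2) ^ 2 / t) := by
      rw [← exp_add, hcs]
      congr 1
      field_simp
      ring
    have hsqrt : √(π * t ^ 3) = √π * √t ^ 3 := by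
      have h : √t ^ 3 * √t ^ 3 = t ^ 3 := by rw [← mul_pow, mul_self_sqrt ht.le]
      rw [sqrt_mul pi_pos.le, ← h, sqrt_mul_self (by positivity)]
    have hpos : 0 < √t := sqrt_pos.2 ht
    rw [← mul_assoc (exp (2 * -(a / 2) * c)), ← mul_assoc (exp (2 * (a / 2) * c)),
      exp_mul_exp_neg_sq_mul_sqrt_add_div_sqrt _ _ ht,
      exp_mul_exp_neg_sq_mul_sqrt_add_div_sqrt _ _ ht, neg_sq, ← hexp, hsqrt]
    field_simp
    ring
  have hlim {l : Filter ℝ} {p q : ℝ}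
      (hp : Tendsto (fun t => G (c * √t + -(a / 2) / √t)) l (𝓝 p))
      (hq : Tendsto (fun t => G (c * √t + (a / 2) / √t)) l (𝓝 q)) :=
    ((hp.const_mul (exp (2 * (-(a / 2)) * c))).sub
      (hq.const_mul (exp (2 * (a / 2) * c)))).const_mul (√π)⁻¹
  have hzero := hlim
    (tendsto_integral_exp_neg_sq_atBot.comp
      (tendsto_mul_sqrt_add_div_sqrt_nhdsGT_of_neg (b := -(a / 2)) (by linarith) c))
    (tendsto_integral_exp_neg_sq_atTop.comp
      (tendsto_mul_sqrt_add_div_sqrt_nhdsGT_of_pos (half_pos ha) c))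
  have htop := hlim
    (tendsto_integral_exp_neg_sq_atTop.comp (tendsto_mul_sqrt_add_div_sqrt_atTop _ hc))
    (tendsto_integral_exp_neg_sq_atTop.comp (tendsto_mul_sqrt_add_div_sqrt_atTop _ hc))
  rw [integral_Ioi_of_hasDerivAt_of_nonneg_of_tendsto_nhdsGT hF
    (fun t _ => by positivity) hzero htop]
  rw [show -(a * c) = 2 * -(a / 2) * c by ring]
  field_simp
  ring
end

section
/- Let a > 0 and s > 0. Then ∫_0^∞ e^{−s t} · e^{−a²/(4t)}/√(π t) dt = e^{−a √s}/√s; that is, R_{1/2,1/2}(a,t) = e^{−a²/(4t)}/√(π t) has Laplace transform s ↦ s^{−1/2} e^{−a s^{1/2}}. -/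
open Real MeasureTheory

lemma hasDerivAt_mul_sub_div (b c : ℝ) {x : ℝ} (hx : x ≠ 0) :
    HasDerivAt (fun x : ℝ => b * x - c / x) (b + c / x ^ 2) x := by
  have h := ((hasDerivAt_id x).const_mul b).sub ((hasDerivAt_inv hx).const_mul c)
  exact h.congr_deriv (by ring)

lemma strictMonoOn_mul_sub_div {b c : ℝ} (hb : 0 < b) (hc : 0 < c) :
    StrictMonoOn (fun x : ℝ => b * x - c / x) (Set.Ioi 0) := by
  intro x hx y hy hxy
  have h₁ : b * x < b * y := by gcongr
  have h₂ : c / y < c / x := div_lt_div_of_pos_left hc hx hxy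
  simp only
  linarith

lemma image_mul_sub_div_Ioi {b c : ℝ} (hb : 0 < b) (hc : 0 < c) :
    (fun x : ℝ => b * x - c / x) '' Set.Ioi 0 = Set.univ := by
  refine Set.eq_univ_of_forall fun y => ?_
  have hd : 0 < y ^ 2 + 4 * b * c := by positivity
  have hsq := Real.sq_sqrt hd.le
  have hpos : 0 < y + √(y ^ 2 + 4 * b * c) := by
    have : |y| < √(y ^ 2 + 4 * b * c) := by
      rw [← Real.sqrt_sq_eq_abs]
      exact Real.sqrt_lt_sqrt (sq_nonneg y) (by nlinarith [mul_pos hb hc])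
    linarith [neg_abs_le y]
  refine ⟨(y + √(y ^ 2 + 4 * b * c)) / (2 * b), div_pos hpos (by positivity), ?_⟩
  have := hpos.ne'
  simp only
  generalize √(y ^ 2 + 4 * b * c) = r at *
  field_simp
  linear_combination hsq

/-- The reflection `x ↦ c / (b * x)` changes the sign of `b * x - c / x`. -/
lemma integral_comp_mul_sub_div_reflect {f : ℝ → ℝ} (hf : ∀ x, f (-x) = f x) {b c : ℝ}
    (hb : 0 < b) (hc : 0 < c) :
    ∫ x in Set.Ioi (0 : ℝ), c / x ^ 2 * f (b * x - c / x)
      = b * ∫ x in Set.Ioi (0 : ℝ), f (b * x - c / x) := by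
  have himage : (fun x : ℝ => c / b * x⁻¹) '' Set.Ioi 0 = Set.Ioi 0 := by
    ext y
    constructor
    · rintro ⟨x, hx, rfl⟩
      exact mul_pos (div_pos hc hb) (inv_pos.2 hx)
    · intro hy
      have hy' : y ≠ 0 := ne_of_gt hy
      refine ⟨c / b * y⁻¹, mul_pos (div_pos hc hb) (inv_pos.2 hy), ?_⟩
      simp only
      field_simp
  have hinj : Set.InjOn (fun x : ℝ => c / b * x⁻¹) (Set.Ioi 0) := fun x _ y _ h =>
    inv_injective (mul_left_cancel₀ (div_pos hc hb).ne' h)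
  have h := integral_image_eq_integral_abs_deriv_smul measurableSet_Ioi
    (fun x hx => ((hasDerivAt_inv (ne_of_gt hx)).const_mul (c / b)).hasDerivWithinAt) hinj
    (fun x => f (b * x - c / x))
  rw [himage] at h
  rw [h, ← integral_const_mul]
  refine setIntegral_congr_fun measurableSet_Ioi fun x hx => ?_
  have hx' : (0 : ℝ) < x := hx
  have harg : b * (c / b * x⁻¹) - c / (c / b * x⁻¹) = -(b * x - c / x) := by
    field_simp
    ring
  have habs : |c / b * -(x ^ 2)⁻¹| = c / b * (x ^ 2)⁻¹ := by
    rw [mul_neg, abs_neg, abs_of_pos (by positivity)]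
  simp only [smul_eq_mul]
  rw [harg, hf, habs]
  field_simp

/-- The Cauchy–Schlömilch transformation for even integrable functions. -/
lemma integral_comp_mul_sub_div_Ioi {f : ℝ → ℝ} (hf : ∀ x, f (-x) = f x) (hf_int : Integrable f)
    {b c : ℝ} (hb : 0 < b) (hc : 0 < c) :
    ∫ x in Set.Ioi (0 : ℝ), f (b * x - c / x) = (∫ u, f u) / (2 * b) := by
  have hderiv : ∀ x ∈ Set.Ioi (0 : ℝ), HasDerivWithinAt (fun x : ℝ => b * x - c / x)
      (b + c / x ^ 2) (Set.Ioi 0) x :=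
    fun x hx => (hasDerivAt_mul_sub_div b c (ne_of_gt hx)).hasDerivWithinAt
  have hinj := (strictMonoOn_mul_sub_div hb hc).injOn
  have hpos : ∀ x : ℝ, 0 < b + c / x ^ 2 := fun x => by positivity
  have hI := (integrableOn_image_iff_integrableOn_abs_deriv_smul measurableSet_Ioi hderiv hinj
    f).1 (by rw [image_mul_sub_div_Ioi hb hc]; exact hf_int.integrableOn)
  have hE := integral_image_eq_integral_abs_deriv_smul measurableSet_Ioi hderiv hinj f
  rw [image_mul_sub_div_Ioi hb hc, setIntegral_univ] at hE
  simp only [abs_of_pos (hpos _), smul_eq_mul] at hI hE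
  have hcomp : IntegrableOn (fun x : ℝ => f (b * x - c / x)) (Set.Ioi 0) := by
    have h := Integrable.bdd_mul (f := fun x : ℝ => (b + c / x ^ 2)⁻¹) (c := b⁻¹) hI
      (Measurable.aestronglyMeasurable (by fun_prop)) (ae_of_all _ fun x => by
        rw [Real.norm_of_nonneg (inv_pos.2 (hpos x)).le]
        gcongr
        exact le_add_of_nonneg_right (by positivity))
    refine h.congr (ae_of_all _ fun x => ?_)
    exact inv_mul_cancel_left₀ (hpos x).ne' _
  have hrest : IntegrableOn (fun x : ℝ => c / x ^ 2 * f (b * x - c / x)) (Set.Ioi 0) := by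
    refine (hI.sub (hcomp.const_mul b)).congr (ae_of_all _ fun x => ?_)
    simp only [Pi.sub_apply]
    ring
  simp only [add_mul] at hE
  rw [integral_add (hcomp.const_mul b) hrest, integral_const_mul,
    integral_comp_mul_sub_div_reflect hf hb hc] at hE
  rw [hE]
  field_simp
  ring

theorem laplace_transform_R_half_half (a s : ℝ) (ha : 0 < a) (hs : 0 < s) :
    ∫ t in Set.Ioi (0 : ℝ),
        Real.exp (-(s * t)) * (Real.exp (-(a ^ 2) / (4 * t)) / Real.sqrt (π * t))
      = Real.exp (-(a * Real.sqrt s)) / Real.sqrt s := by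
  have hb : 0 < √s := Real.sqrt_pos.2 hs
  have hsq : √s ^ 2 = s := Real.sq_sqrt hs.le
  have hπ : 0 < √π := Real.sqrt_pos.2 Real.pi_pos
  have hgauss := integral_comp_mul_sub_div_Ioi (f := fun u => exp (-1 * u ^ 2)) (by simp)
    (integrable_exp_neg_mul_sq one_pos) hb (half_pos ha)
  rw [integral_gaussian, div_one] at hgauss
  rw [← integral_comp_rpow_Ioi_of_pos (p := 2) two_pos]
  have hcongr : Set.EqOn
      (fun x : ℝ => (2 * x ^ ((2 : ℝ) - 1)) • (exp (-(s * x ^ (2 : ℝ))) *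
        (exp (-(a ^ 2) / (4 * x ^ (2 : ℝ))) / √(π * x ^ (2 : ℝ)))))
      (fun x : ℝ => 2 / √π * exp (-(a * √s)) * exp (-1 * (√s * x - a / 2 / x) ^ 2))
      (Set.Ioi 0) := by
    intro x hx
    have hx' : (0 : ℝ) < x := hx
    have hone : (2 : ℝ) - 1 = 1 := by norm_num
    have hexp : exp (-(s * x ^ 2)) * exp (-(a ^ 2) / (4 * x ^ 2))
        = exp (-(a * √s)) * exp (-1 * (√s * x - a / 2 / x) ^ 2) := by
      rw [← exp_add, ← exp_add]
      congr 1
      field_simp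
      linear_combination 16 * x ^ 4 * hsq
    simp only [smul_eq_mul, rpow_two, hone, rpow_one]
    rw [Real.sqrt_mul Real.pi_pos.le, Real.sqrt_sq hx'.le, ← mul_div_assoc, hexp]
    field_simp
  rw [setIntegral_congr_fun measurableSet_Ioi hcongr, integral_const_mul, hgauss]
  field_simp
end
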